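/- The braid group B₃ on three strings, i.e., the group with presentation ⟨x, y ‖ x y x = y x y⟩, admits a faithful representation by integer matrices of dimension 24; that is, there is an injective group homomorphism B₃ → GL_{24}(ℤ). -/

import Mathlib

open scoped MatrixGroups

/-- The defining relation `x y x = y x y` of the braid group `B₃`. -/
def braid3Rels : Set (FreeGroup (Fin 2)) :=
  {FreeGroup.of 0 * FreeGroup.of 1 * FreeGroup.of 0 *
    (FreeGroup.of 1 * FreeGroup.of 0 * FreeGroup.of 1)⁻¹}

/-- The braid group `B₃ = ⟨x, y ‖ x y x = y x y⟩` on three strings. -/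
abbrev BraidGroup3 := PresentedGroup braid3Rels

namespace Braid3

section NormalForm

variable {G : Type*} [Group G]

/-- The monoid generated by `b⁻¹ a` and `b⁻² a`. -/
def positiveMonoid (a b : G) : Submonoid G :=
  Submonoid.closure {b⁻¹ * a, b⁻¹ * b⁻¹ * a}

/-- `g` is a power of `a²` times `s m t` with `s ∈ {1, a}`, `m` in the positive monoid and
`t ∈ {1, b, b²}`. -/
def HasNormalForm (a b g : G) : Prop :=
  ∃ k : ℤ, ∃ s, (s = 1 ∨ s = a) ∧ ∃ m ∈ positiveMonoid a b,
    ∃ t, (t = 1 ∨ t = b ∨ t = b * b) ∧ g = (a * a) ^ k * (s * m * t)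

variable {a b g : G}

theorem HasNormalForm.one : HasNormalForm a b 1 :=
  ⟨0, 1, .inl rfl, 1, one_mem _, 1, .inl rfl, by simp⟩

theorem HasNormalForm.zpow_mul (n : ℤ) (hg : HasNormalForm a b g) :
    HasNormalForm a b ((a * a) ^ n * g) := by
  obtain ⟨k, s, hs, m, hm, t, ht, rfl⟩ := hg
  exact ⟨n + k, s, hs, m, hm, t, ht, by simp only [zpow_add, mul_assoc]⟩

theorem HasNormalForm.left_mul (hg : HasNormalForm a b g) : HasNormalForm a b (a * g) := by
  obtain ⟨k, s, hs, m, hm, t, ht, rfl⟩ := hg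
  have hc : Commute a ((a * a) ^ k) :=
    ((Commute.refl a).mul_right (Commute.refl a)).zpow_right k
  rw [← mul_assoc, hc.eq, mul_assoc]
  apply HasNormalForm.zpow_mul
  rcases hs with rfl | rfl
  · exact ⟨0, a, .inr rfl, m, hm, t, ht, by simp [mul_assoc]⟩
  · exact ⟨1, 1, .inl rfl, m, hm, t, ht, by simp [mul_assoc]⟩

theorem positiveMonoid_cases {m : G} (hm : m ∈ positiveMonoid a b) :
    m = 1 ∨ ∃ m' ∈ positiveMonoid a b, m = b⁻¹ * a * m' ∨ m = b⁻¹ * b⁻¹ * a * m' := by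
  induction hm using Submonoid.closure_induction_left with
  | one => exact .inl rfl
  | mul_left x hx y hy _ =>
    rcases hx with rfl | rfl
    · exact .inr ⟨y, hy, .inl rfl⟩
    · exact .inr ⟨y, hy, .inr rfl⟩

theorem HasNormalForm.right_mul (hab : a * a = b * b * b) (hg : HasNormalForm a b g) :
    HasNormalForm a b (b * g) := by
  obtain ⟨k, s, hs, m, hm, t, ht, rfl⟩ := hg
  have hc : Commute b ((a * a) ^ k) := by
    rw [hab]
    exact (((Commute.refl b).mul_right (Commute.refl b)).mul_right (Commute.refl b)).zpow_right k
  rw [← mul_assoc, hc.eq, mul_assoc]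
  apply HasNormalForm.zpow_mul
  rcases hs with rfl | rfl
  · rcases positiveMonoid_cases hm with rfl | ⟨m', hm', rfl | rfl⟩
    · rcases ht with rfl | ht | rfl
      · exact ⟨0, 1, .inl rfl, 1, one_mem _, b, .inr (.inl rfl), by simp⟩
      · exact ⟨0, 1, .inl rfl, 1, one_mem _, b * b, .inr (.inr rfl), by simp [ht]⟩
      · exact ⟨1, 1, .inl rfl, 1, one_mem _, 1, .inl rfl, by simp [hab, mul_assoc]⟩
    · exact ⟨0, a, .inr rfl, m', hm', t, ht, by simp [mul_assoc]⟩
    · exact ⟨0, 1, .inl rfl, b⁻¹ * a * m',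
        mul_mem (Submonoid.subset_closure (.inl rfl)) hm', t, ht, by simp [mul_assoc]⟩
  · refine ⟨1, 1, .inl rfl, b⁻¹ * b⁻¹ * s * m,
      mul_mem (Submonoid.subset_closure (.inr rfl)) hm, t, ht, ?_⟩
    rw [hab]
    simp [mul_assoc]

end NormalForm

/-- The first standard generator of `B₃`. -/
def x : BraidGroup3 := PresentedGroup.of 0

/-- The second standard generator of `B₃`. -/
def y : BraidGroup3 := PresentedGroup.of 1

theorem braid_relation : x * y * x = y * x * y := by
  have h := PresentedGroup.one_of_mem (rels := braid3Rels) rfl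
  rwa [map_mul, map_inv, mul_inv_eq_one, map_mul, map_mul, map_mul, map_mul] at h

theorem center_eq : x * y * x * (x * y * x) = x * y * (x * y) * (x * y) := by
  calc x * y * x * (x * y * x) = x * y * x * (y * x * y) := by rw [← braid_relation]
    _ = x * y * (x * y) * (x * y) := by simp only [mul_assoc]

theorem hasNormalForm (g : BraidGroup3) : HasNormalForm (x * y * x) (x * y) g := by
  have hg : g ∈ Subgroup.closure (Set.range PresentedGroup.of) := by
    rw [PresentedGroup.closure_range_of]; trivial
  have hz : ∀ w v : BraidGroup3, x * y * x * (x * y * x) * w = v →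
      w = (x * y * x * (x * y * x)) ^ (-1 : ℤ) * v := by
    rintro w _ rfl; rw [zpow_neg_one, inv_mul_cancel_left]
  induction hg using Subgroup.closure_induction_left with
  | one => exact .one
  | mul_left u hu v _ ih =>
    obtain ⟨i, rfl⟩ := hu
    fin_cases i
    · change HasNormalForm _ _ (x * v)
      rw [hz (x * v) (x * y * (x * y * (x * y * x * v))) (by
        rw [center_eq]; simp only [mul_assoc])]
      exact ((ih.left_mul.right_mul center_eq).right_mul center_eq).zpow_mul _
    · change HasNormalForm _ _ (y * v)
      rw [hz (y * v) (x * y * x * (x * y * (x * y * v))) (by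
        simp only [mul_assoc])]
      exact ((ih.right_mul center_eq).right_mul center_eq).left_mul.zpow_mul _
  | inv_mul_cancel u hu v _ ih =>
    obtain ⟨i, rfl⟩ := hu
    fin_cases i
    · change HasNormalForm _ _ (x⁻¹ * v)
      rw [hz (x⁻¹ * v) (x * y * x * (x * y * v)) (by simp [mul_assoc])]
      exact (ih.right_mul center_eq).left_mul.zpow_mul _
    · change HasNormalForm _ _ (y⁻¹ * v)
      rw [hz (y⁻¹ * v) (x * y * (x * y * x * v)) (by
        rw [center_eq]; simp [mul_assoc])]
      exact (ih.left_mul.right_mul center_eq).zpow_mul _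

/-- The homomorphism from `B₃` given by two elements satisfying the braid relation. -/
def lift {H : Type*} [Group H] (X Y : H) (h : X * Y * X = Y * X * Y) : BraidGroup3 →* H :=
  PresentedGroup.toGroup (f := ![X, Y]) (by
    rintro r rfl
    rw [map_mul, map_inv, mul_inv_eq_one]
    simpa using h)

section Lift

variable {H : Type*} [Group H] (X Y : H) (h : X * Y * X = Y * X * Y)

@[simp] theorem lift_x : lift X Y h x = X := PresentedGroup.toGroup.of _

@[simp] theorem lift_y : lift X Y h y = Y := PresentedGroup.toGroup.of _

end Lift

/-- The image of the second generator in `SL(2, ℤ)`. -/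
def lowerUnipotent : SL(2, ℤ) := ⟨!![1, 0; -1, 1], by simp⟩

theorem lowerUnipotent_braid :
    ModularGroup.T * lowerUnipotent * ModularGroup.T =
      lowerUnipotent * ModularGroup.T * lowerUnipotent := by
  apply Subtype.ext
  simp only [Matrix.SpecialLinearGroup.coe_mul]
  simp [ModularGroup.T, lowerUnipotent]

/-- The standard surjection `B₃ → SL(2, ℤ)`. -/
def toSL : BraidGroup3 →* SL(2, ℤ) :=
  lift ModularGroup.T lowerUnipotent lowerUnipotent_braid

/-- The exponent sum, as an upper unipotent matrix. -/
def exponentSum : BraidGroup3 →* SL(2, ℤ) := lift ModularGroup.T ModularGroup.T rfl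

theorem toSL_x : (toSL x : Matrix (Fin 2) (Fin 2) ℤ) = !![1, 1; 0, 1] := by
  rw [toSL, lift_x]; rfl

theorem toSL_y : (toSL y : Matrix (Fin 2) (Fin 2) ℤ) = !![1, 0; -1, 1] := by
  rw [toSL, lift_y]; rfl

theorem toSL_b : (toSL (x * y) : Matrix (Fin 2) (Fin 2) ℤ) = !![0, 1; -1, 1] := by
  simp [toSL_x, toSL_y]

theorem toSL_a : (toSL (x * y * x) : Matrix (Fin 2) (Fin 2) ℤ) = !![0, 1; -1, 0] := by
  simp [toSL_x, toSL_y]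

theorem toSL_center_zpow (k : ℤ) :
    (toSL ((x * y * x * (x * y * x)) ^ k) : Matrix (Fin 2) (Fin 2) ℤ) = 1 ∨
    (toSL ((x * y * x * (x * y * x)) ^ k) : Matrix (Fin 2) (Fin 2) ℤ) = -1 := by
  have h : toSL (x * y * x * (x * y * x)) = -1 := by
    apply Subtype.ext
    rw [map_mul, Matrix.SpecialLinearGroup.coe_mul, toSL_a]
    ext i j
    fin_cases i <;> fin_cases j <;> simp
  rw [map_zpow, h]
  rcases Int.even_or_odd k with hk | hk
  · left; simp [hk.neg_one_zpow]
  · right; simp [hk.neg_one_zpow]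

theorem toSL_positive {m : BraidGroup3} (hm : m ∈ positiveMonoid (x * y * x) (x * y)) :
    1 ≤ toSL m 0 0 ∧ 0 ≤ toSL m 0 1 ∧ 0 ≤ toSL m 1 0 ∧ 1 ≤ toSL m 1 1 ∧
      (m = 1 ∨ 1 ≤ toSL m 0 1 + toSL m 1 0) := by
  induction hm using Submonoid.closure_induction_left with
  | one => simp
  | mul_left u hu v _ ih =>
    obtain ⟨h00, h01, h10, h11, -⟩ := ih
    rcases hu with rfl | rfl
    · have hx : (x * y)⁻¹ * (x * y * x) = x := by group
      rw [hx, map_mul, Matrix.SpecialLinearGroup.coe_mul, toSL_x]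
      simp [Matrix.mul_apply, Fin.sum_univ_two]
      omega
    · have hy : (x * y)⁻¹ * (x * y)⁻¹ * (x * y * x) = y⁻¹ := by group
      have hY : (toSL y⁻¹ : Matrix (Fin 2) (Fin 2) ℤ) = !![1, 0; 1, 1] := by
        rw [map_inv, Matrix.SpecialLinearGroup.coe_inv, toSL_y, Matrix.adjugate_fin_two]
        simp
      rw [hy, map_mul, Matrix.SpecialLinearGroup.coe_mul, hY]
      simp [Matrix.mul_apply, Fin.sum_univ_two]
      omega

theorem eq_one_of_toSL_of_exponentSum {g : BraidGroup3} (h₁ : toSL g = 1)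
    (h₂ : exponentSum g = 1) : g = 1 := by
  obtain ⟨k, s, hs, m, hm, t, ht, rfl⟩ := hasNormalForm g
  have key : s = 1 ∧ m = 1 ∧ t = 1 := by
    obtain ⟨h00, h01, h10, h11, hm1⟩ := toSL_positive hm
    have hS : s = 1 ∧ (toSL s : Matrix (Fin 2) (Fin 2) ℤ) = 1 ∨
        (toSL s : Matrix (Fin 2) (Fin 2) ℤ) = !![0, 1; -1, 0] := by
      rcases hs with rfl | rfl
      · simp
      · exact .inr toSL_a
    have hT : t = 1 ∧ (toSL t : Matrix (Fin 2) (Fin 2) ℤ) = 1 ∨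
        (toSL t : Matrix (Fin 2) (Fin 2) ℤ) = !![0, 1; -1, 1] ∨
        (toSL t : Matrix (Fin 2) (Fin 2) ℤ) = !![-1, 1; -1, 0] := by
      rcases ht with rfl | rfl | rfl
      · simp
      · exact .inr (.inl toSL_b)
      · right; right
        rw [map_mul, Matrix.SpecialLinearGroup.coe_mul, toSL_b]
        simp
    have h := congrArg (fun M : SL(2, ℤ) => (M : Matrix (Fin 2) (Fin 2) ℤ)) h₁
    rw [map_mul, map_mul, map_mul] at h
    simp only [Matrix.SpecialLinearGroup.coe_mul, Matrix.SpecialLinearGroup.coe_one] at h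
    have e00 := congrFun (congrFun h 0) 0
    have e01 := congrFun (congrFun h 0) 1
    have e10 := congrFun (congrFun h 1) 0
    have e11 := congrFun (congrFun h 1) 1
    rcases toSL_center_zpow k with hk | hk <;> rcases hS with ⟨hs1, hS⟩ | hS <;>
      rcases hT with ⟨ht1, hT⟩ | hT | hT <;>
      rw [hk, hS, hT] at e00 e01 e10 e11 <;>
      simp [Matrix.mul_apply, Fin.sum_univ_two, -Matrix.cons_mul] at e00 e01 e10 e11 <;>
      first
      | omega
      | exact ⟨hs1, hm1.resolve_right (by omega), ht1⟩
  obtain ⟨rfl, rfl, rfl⟩ := key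
  have hT : exponentSum (x * y * x * (x * y * x)) = ModularGroup.T ^ (6 : ℤ) := by
    simp only [exponentSum, map_mul, lift_x, lift_y, zpow_ofNat, pow_succ, pow_zero, one_mul, mul_assoc]
  have hk : ModularGroup.T ^ (6 * k) = 1 := by
    simpa [zpow_mul, hT, -map_mul, map_mul exponentSum (_ ^ k)] using h₂
  have h01 := congrArg (fun M : SL(2, ℤ) => M 0 1) hk
  simp [ModularGroup.coe_T_zpow] at h01
  simp [h01]

/-- The block diagonal representation of `B₃` with one block `toSL` and eleven blocks
`exponentSum`. -/
def blockRep : BraidGroup3 →* Matrix (Fin 24) (Fin 24) ℤ :=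
  (Matrix.reindexRingEquiv ℤ (finProdFinEquiv (m := 2) (n := 12))).toMonoidHom.comp
    ((Matrix.blockDiagonalRingHom (Fin 2) (Fin 12) ℤ).toMonoidHom.comp
      (MonoidHom.pi fun i =>
        Matrix.SpecialLinearGroup.coeMonoidHom.comp (if i = 0 then toSL else exponentSum)))

theorem blockRep_injective : Function.Injective blockRep := by
  rw [injective_iff_map_eq_one]
  intro g hg
  have h : Matrix.blockDiagonal (fun i : Fin 12 =>
      (Matrix.SpecialLinearGroup.coeMonoidHom.comp (if i = 0 then toSL else exponentSum)) g) = 1 :=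
    (Matrix.reindexRingEquiv ℤ (finProdFinEquiv (m := 2) (n := 12))).injective
      (by rw [map_one]; exact hg)
  have h' := Matrix.blockDiagonal_injective (h.trans Matrix.blockDiagonal_one.symm)
  apply eq_one_of_toSL_of_exponentSum
  · exact Matrix.SpecialLinearGroup.coeMonoidHom_injective (congrFun h' 0)
  · exact Matrix.SpecialLinearGroup.coeMonoidHom_injective (congrFun h' 1)

end Braid3

/-- The braid group `B₃` admits a faithful representation by integer matrices of
dimension 24. -/
theorem braid3_integer_rep :
    ∃ ρ : BraidGroup3 →* GL (Fin 24) ℤ, Function.Injective ρ :=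
  ⟨Braid3.blockRep.toHomUnits, fun _ _ h =>
    Braid3.blockRep_injective (congrArg Units.val h)⟩
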